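/- arXiv:2502.03027 — 2 statements merged into one kernel-verified Lean document; each statement's English description precedes it below -/
import Mathlib

section
/- Let A > 0, B ∈ ℝ, R > 0 with 4|B|R ≤ π, and let a₁(k) = 1 + A² e^{4ikR} / (4(k² − B²)) for complex k ≠ ±B. Suppose there exists a positive integer n such that (2n−1)π/(2√(4B² + A²)) < R ≤ (2n+1)π/(2√(4B² + A²)). Then the set of zeros of a₁ with Im k > 0 and Re k ≠ 0 consists of exactly 2n points, all simple zeros; this set is invariant under the map p ↦ −conj(p); and its n elements p₁, …, p_n with negative real part can be ordered so that Re p_j ∈ (−jπ/(2R), (1−2j)π/(4R)) for each j = 1, …, n, with exactly one zero with negative real part in each of these n intervals. -/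
/-- For `w = -u + iv`, the real and imaginary parts of the equation `w² - c = -a e^{iw}`. -/
def IsZeroPair (a c u v : ℝ) : Prop :=
  u ^ 2 - v ^ 2 - c = -(a * Real.exp (-v) * Real.cos u) ∧
    2 * u * v = -(a * Real.exp (-v) * Real.sin u)

namespace IsZeroPair

variable {a c u v u₁ v₁ u₂ v₂ : ℝ}

lemma normSq_eq (h : IsZeroPair a c u v) :
    (u ^ 2 - c) ^ 2 + 2 * v ^ 2 * (u ^ 2 + c) + v ^ 4 = (a * Real.exp (-v)) ^ 2 := by
  obtain ⟨h₁, h₂⟩ := h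
  have h₃ : (u ^ 2 - v ^ 2 - c) ^ 2 + (2 * u * v) ^ 2 = (a * Real.exp (-v)) ^ 2 := by
    rw [h₁, h₂]
    linear_combination (a * Real.exp (-v)) ^ 2 * Real.sin_sq_add_cos_sq u
  linear_combination h₃

lemma sq_lt (h : IsZeroPair a c u v) (ha : 0 < a) (hc : 0 ≤ c) (hv : 0 < v) :
    u ^ 2 < a + c := by
  have h₁ := h.normSq_eq
  have h₂ : Real.exp (-v) < 1 := by simpa using hv
  have h₃ : a * Real.exp (-v) < a := by nlinarith
  have h₄ : 0 < a * Real.exp (-v) := by positivity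
  have h₅ : 0 < 2 * v ^ 2 * (u ^ 2 + c) + v ^ 4 := by positivity
  have h₆ : (u ^ 2 - c) ^ 2 < a ^ 2 := by nlinarith
  linarith [lt_of_pow_lt_pow_left₀ 2 ha.le h₆]

lemma sin_sub_eq (h₁ : IsZeroPair a c u₁ v₁) (h₂ : IsZeroPair a c u₂ v₂) :
    (a * Real.exp (-v₁)) * (a * Real.exp (-v₂)) * Real.sin (u₂ - u₁) =
      2 * u₂ * v₂ * (u₁ ^ 2 - v₁ ^ 2 - c) - 2 * u₁ * v₁ * (u₂ ^ 2 - v₂ ^ 2 - c) := by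
  rw [h₁.1, h₁.2, h₂.1, h₂.2, Real.sin_sub]
  ring

lemma not_lt_of_sub_lt_pi (h₁ : IsZeroPair a c u₁ v₁) (h₂ : IsZeroPair a c u₂ v₂) (ha : 0 < a)
    (hc : 0 ≤ c) (hu₁ : 0 < u₁) (hcu : c < u₁ ^ 2) (hv₁ : 0 < v₁) (hv₂ : 0 < v₂)
    (hπ : u₂ - u₁ < Real.pi) : ¬ u₁ < u₂ := by
  intro hlt
  have hsin := Real.sin_pos_of_pos_of_lt_pi (sub_pos.2 hlt) hπ
  have hpos : 0 < (a * Real.exp (-v₁)) * (a * Real.exp (-v₂)) * Real.sin (u₂ - u₁) := by positivity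
  rw [sin_sub_eq h₁ h₂] at hpos
  have hu₂ : 0 < u₂ := hu₁.trans hlt
  have hv : v₁ < v₂ := by
    by_contra! hv
    have e₁ : u₁ * v₂ ≤ u₂ * v₁ := by gcongr
    have e₂ : u₂ * (u₁ ^ 2 - c) ≤ u₁ * (u₂ ^ 2 - c) := by
      nlinarith [mul_nonneg (mul_pos hu₁ hu₂).le (sub_pos.2 hlt).le,
        mul_nonneg hc (sub_pos.2 hlt).le]
    have e₃ : v₂ * (u₂ * (u₁ ^ 2 - c)) ≤ v₁ * (u₁ * (u₂ ^ 2 - c)) := by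
      have : 0 ≤ u₂ * (u₁ ^ 2 - c) := mul_nonneg hu₂.le (sub_pos.2 hcu).le
      gcongr
    nlinarith [mul_nonneg (mul_pos hv₁ hv₂).le (sub_nonneg.2 e₁)]
  have hexp : (a * Real.exp (-v₂)) ^ 2 < (a * Real.exp (-v₁)) ^ 2 := by
    gcongr
  rw [← h₁.normSq_eq, ← h₂.normSq_eq] at hexp
  have e₁ : u₁ ^ 2 < u₂ ^ 2 := by gcongr
  have e₂ : v₁ ^ 2 < v₂ ^ 2 := by gcongr
  have e₃ : v₁ ^ 4 < v₂ ^ 4 := by gcongr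
  have e₄ : (u₁ ^ 2 - c) ^ 2 < (u₂ ^ 2 - c) ^ 2 := by
    have : 0 ≤ u₁ ^ 2 - c := (sub_pos.2 hcu).le
    gcongr
  have e₅ : v₁ ^ 2 * (u₁ ^ 2 + c) ≤ v₂ ^ 2 * (u₂ ^ 2 + c) := by gcongr
  linarith

lemma snd_eq (h₁ : IsZeroPair a c u v₁) (h₂ : IsZeroPair a c u v₂) (hu : 0 < u)
    (hcu : c < u ^ 2) (hv₁ : 0 < v₁) (hv₂ : 0 < v₂) : v₁ = v₂ := by
  have h := sin_sub_eq h₁ h₂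
  rw [sub_self, Real.sin_zero, mul_zero] at h
  have h' : (2 * u * (u ^ 2 - c + v₁ * v₂)) * (v₂ - v₁) = 0 := by linear_combination -h
  have : 0 < 2 * u * (u ^ 2 - c + v₁ * v₂) := by
    have := sub_pos.2 hcu
    positivity
  rcases mul_eq_zero.1 h' with h' | h' <;> linarith

/-- There is at most one zero with `u` in each half-period on which the sine is negative. -/
lemma unique (h₁ : IsZeroPair a c u₁ v₁) (h₂ : IsZeroPair a c u₂ v₂) (ha : 0 < a)
    (hc : 0 ≤ c) (hu₁ : 0 < u₁) (hu₂ : 0 < u₂) (hcu₁ : c < u₁ ^ 2) (hcu₂ : c < u₂ ^ 2)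
    (hv₁ : 0 < v₁) (hv₂ : 0 < v₂) (hπ₁ : u₂ - u₁ < Real.pi) (hπ₂ : u₁ - u₂ < Real.pi) :
    u₁ = u₂ ∧ v₁ = v₂ := by
  have hu : u₁ = u₂ := le_antisymm
    (not_lt.1 (not_lt_of_sub_lt_pi h₂ h₁ ha hc hu₂ hcu₂ hv₂ hv₁ hπ₂))
    (not_lt.1 (not_lt_of_sub_lt_pi h₁ h₂ ha hc hu₁ hcu₁ hv₁ hv₂ hπ₁))
  subst hu
  exact ⟨rfl, snd_eq h₁ h₂ hu₁ hcu₁ hv₁ hv₂⟩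

lemma exists_nat (h : IsZeroPair a c u v) (ha : 0 < a) (hu : 0 < u) (hv : 0 < v) :
    ∃ j : ℕ, (2 * j + 1) * Real.pi < u ∧ u < (2 * j + 2) * Real.pi := by
  have hπ := Real.pi_pos
  have hsin : Real.sin u < 0 := by
    by_contra! hs
    have h₁ : 0 ≤ a * Real.exp (-v) * Real.sin u := by positivity
    have h₂ : 0 < 2 * u * v := by positivity
    linarith [h.2]
  have h₁ := Nat.floor_le (show 0 ≤ u / (2 * Real.pi) by positivity)
  have h₂ := Nat.lt_floor_add_one (u / (2 * Real.pi))
  rw [le_div_iff₀ (by positivity)] at h₁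
  rw [div_lt_iff₀ (by positivity)] at h₂
  refine ⟨⌊u / (2 * Real.pi)⌋₊, ?_, by linarith⟩
  by_contra! hle
  rw [← Real.sin_sub_nat_mul_two_pi u ⌊u / (2 * Real.pi)⌋₊] at hsin
  exact hsin.not_ge (Real.sin_nonneg_of_nonneg_of_le_pi (by linarith) (by linarith))

end IsZeroPair

open Real in
/-- Solving the quotient of the two equations for `v` reduces existence to the intermediate
value theorem in `t = u - (2j + 1)π`. -/
lemma exists_isZeroPair {a c : ℝ} (hcπ : c ≤ π ^ 2) (j : ℕ)
    (hj : ((2 * j + 1) * π) ^ 2 < a + c) :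
    ∃ u v, (2 * j + 1) * π < u ∧ u < (2 * j + 2) * π ∧ 0 < v ∧ IsZeroPair a c u v := by
  have hπ := pi_pos
  set s : ℝ := (2 * j + 1) * π with hs
  have hsπ : π ≤ s := by
    have : (0 : ℝ) ≤ j := j.cast_nonneg
    nlinarith
  set D : ℝ → ℝ := fun t ↦ √((s + t) ^ 2 - c * sin t ^ 2) + (s + t) * cos t with hD
  set V : ℝ → ℝ := fun t ↦ ((s + t) ^ 2 - c) * sin t / D t with hV
  set H : ℝ → ℝ := fun t ↦ 2 * (s + t) * exp (V t) * ((s + t) ^ 2 - c) / D t with hH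
  have hDc : Continuous D := by fun_prop
  have hgap : ∀ t, 0 < t → c < (s + t) ^ 2 := fun t ht ↦ by nlinarith
  have hrad : ∀ t, 0 ≤ t → 0 ≤ (s + t) ^ 2 - c * sin t ^ 2 := fun t ht ↦ by
    nlinarith [sin_sq_le_one t, sq_nonneg (sin t)]
  have hDpos : ∀ t, 0 ≤ t → t < π → 0 < D t := by
    intro t ht htπ
    rcases ht.eq_or_lt with rfl | ht
    · have : 0 < s := hπ.trans_le hsπ
      have := sqrt_nonneg ((s + 0) ^ 2 - c * sin 0 ^ 2)
      simp only [hD, cos_zero]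
      linarith
    · have hsin := sin_pos_of_pos_of_lt_pi ht htπ
      have : |(s + t) * cos t| < √((s + t) ^ 2 - c * sin t ^ 2) := by
        apply lt_sqrt_of_sq_lt
        rw [sq_abs]
        have : 0 < ((s + t) ^ 2 - c) * sin t ^ 2 := mul_pos (sub_pos.2 (hgap t ht)) (by positivity)
        nlinarith [sin_sq_add_cos_sq t]
      have := neg_abs_le ((s + t) * cos t)
      simp only [hD]
      linarith
  have hVnn : ∀ t, 0 < t → t < π → 0 < V t := fun t ht htπ ↦
    div_pos (mul_pos (sub_pos.2 (hgap t ht)) (sin_pos_of_pos_of_lt_pi ht htπ)) (hDpos t ht.le htπ)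
  obtain ⟨t₀, ht₀, ht₀π, hbig⟩ : ∃ t₀, 0 < t₀ ∧ t₀ < π ∧
      a * D t₀ < 2 * (s + t₀) * ((s + t₀) ^ 2 - c) := by
    have hDπ : D π = 0 := by
      have : 0 ≤ s + π := by linarith
      simp [hD, sqrt_sq this]
    have hlt : a * D π < 2 * (s + π) * ((s + π) ^ 2 - c) := by
      rw [hDπ, mul_zero]
      have := sub_pos.2 (hgap π hπ)
      positivity
    have hev : ∀ᶠ t in nhdsWithin π (Set.Iio π), a * D t < 2 * (s + t) * ((s + t) ^ 2 - c) :=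
      ((hDc.const_mul a).continuousAt.eventually_lt
        (Continuous.continuousAt (by fun_prop)) hlt).filter_mono nhdsWithin_le_nhds
    obtain ⟨t, ht, ht'⟩ := (hev.and (Ioo_mem_nhdsLT hπ)).exists
    exact ⟨t, ht'.1, ht'.2, ht⟩
  have hne : ∀ t ∈ Set.Icc 0 t₀, D t ≠ 0 := fun t ht ↦ (hDpos t ht.1 (ht.2.trans_lt ht₀π)).ne'
  have hVc : ContinuousOn V (Set.Icc 0 t₀) :=
    ContinuousOn.div (by fun_prop) hDc.continuousOn hne
  have hHc : ContinuousOn H (Set.Icc 0 t₀) :=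
    ContinuousOn.div (by fun_prop) hDc.continuousOn hne
  have hH0 : H 0 < a := by
    have h0 : 0 < s := hπ.trans_le hsπ
    have : H 0 = s ^ 2 - c := by
      simp only [hH, hV, hD, sin_zero, cos_zero]
      simp [sqrt_sq h0.le]
      field_simp
      ring
    linarith
  have hHt₀ : a < H t₀ := by
    have hd := hDpos t₀ ht₀.le ht₀π
    simp only [hH]
    rw [lt_div_iff₀ hd]
    have h1 : 1 ≤ exp (V t₀) := one_le_exp (hVnn t₀ ht₀ ht₀π).le
    have h2 : 0 < 2 * (s + t₀) * ((s + t₀) ^ 2 - c) :=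
      mul_pos (by linarith) (sub_pos.2 (hgap t₀ ht₀))
    nlinarith
  obtain ⟨t, ⟨ht, htt₀⟩, hHt⟩ := intermediate_value_Ioo ht₀.le hHc ⟨hH0, hHt₀⟩
  have htπ := htt₀.trans ht₀π
  have hd := hDpos t ht.le htπ
  have hVt := hVnn t ht htπ
  have hsin := sin_pos_of_pos_of_lt_pi ht htπ
  have hexp : exp (V t) * exp (-V t) = 1 := by rw [← exp_add]; simp
  have hVD : V t * D t = ((s + t) ^ 2 - c) * sin t := div_mul_cancel₀ _ hd.ne'
  have hHD : a * D t = 2 * (s + t) * exp (V t) * ((s + t) ^ 2 - c) := by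
    rw [← hHt]; exact div_mul_cancel₀ _ hd.ne'
  have hDsq : (D t - (s + t) * cos t) ^ 2 = (s + t) ^ 2 - c * sin t ^ 2 := by
    simp only [hD, add_sub_cancel_right]
    exact sq_sqrt (hrad t ht.le)
  have him : 2 * (s + t) * V t = a * exp (-V t) * sin t := by
    apply mul_right_cancel₀ hd.ne'
    linear_combination 2 * (s + t) * hVD - exp (-V t) * sin t * hHD
      - 2 * (s + t) * ((s + t) ^ 2 - c) * sin t * hexp
  have hquad : V t ^ 2 * sin t + 2 * (s + t) * V t * cos t = ((s + t) ^ 2 - c) * sin t := by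
    apply mul_right_cancel₀ (pow_ne_zero 2 hd.ne')
    linear_combination (sin t * (V t * D t + ((s + t) ^ 2 - c) * sin t)
        + 2 * (s + t) * cos t * D t) * hVD - ((s + t) ^ 2 - c) * sin t * hDsq
      + ((s + t) ^ 2 - c) * sin t * (s + t) ^ 2 * sin_sq_add_cos_sq t
  have hre : (s + t) ^ 2 - V t ^ 2 - c = a * exp (-V t) * cos t := by
    apply mul_right_cancel₀ hsin.ne'
    linear_combination cos t * him - hquad
  have hshift : s + t = t + π + j * (2 * π) := by rw [hs]; ring
  refine ⟨s + t, V t, by linarith, by rw [hs]; linarith, hVt, ?_, ?_⟩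
  · rw [hre, hshift, cos_add_nat_mul_two_pi, cos_add_pi]; ring
  · rw [him, hshift, sin_add_nat_mul_two_pi, sin_add_pi]; ring

lemma four_mul_sq_sub_sq_ne_zero_of_im_pos {k : ℂ} (B : ℝ) (hk : 0 < k.im) :
    4 * (k ^ 2 - (B : ℂ) ^ 2) ≠ 0 := by
  refine mul_ne_zero (by norm_num) fun h ↦ ?_
  rcases sq_eq_sq_iff_eq_or_eq_neg.1 (sub_eq_zero.1 h) with h | h <;> simp [h] at hk

lemma a1_eq_zero_iff {A B R : ℝ} (hR : 0 < R) {k : ℂ} (hk : 0 < k.im) :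
    1 + (A : ℂ) ^ 2 * Complex.exp (4 * Complex.I * k * (R : ℂ)) / (4 * (k ^ 2 - (B : ℂ) ^ 2)) = 0 ↔
      IsZeroPair (4 * R ^ 2 * A ^ 2) (16 * B ^ 2 * R ^ 2) (-(4 * R * k.re)) (4 * R * k.im) := by
  have hne := four_mul_sq_sub_sq_ne_zero_of_im_pos B hk
  have hexp : Complex.exp (4 * Complex.I * k * (R : ℂ)) =
      ⟨Real.exp (-(4 * R * k.im)) * Real.cos (4 * R * k.re),
        Real.exp (-(4 * R * k.im)) * Real.sin (4 * R * k.re)⟩ := by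
    have : 4 * Complex.I * k * (R : ℂ) = ⟨-(4 * R * k.im), 4 * R * k.re⟩ := by
      apply Complex.ext <;> simp <;> ring
    rw [this]
    apply Complex.ext <;> simp [Complex.exp_re, Complex.exp_im]
  have h₁ : 1 + (A : ℂ) ^ 2 * Complex.exp (4 * Complex.I * k * (R : ℂ)) /
        (4 * (k ^ 2 - (B : ℂ) ^ 2)) = 0 ↔
      4 * (k ^ 2 - (B : ℂ) ^ 2) + (A : ℂ) ^ 2 * Complex.exp (4 * Complex.I * k * (R : ℂ)) = 0 := by
    rw [← mul_left_inj' hne, add_mul, one_mul, div_mul_cancel₀ _ hne, zero_mul]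
  have hre : (4 * (k ^ 2 - (B : ℂ) ^ 2) +
      (A : ℂ) ^ 2 * Complex.exp (4 * Complex.I * k * (R : ℂ))).re =
      4 * (k.re ^ 2 - k.im ^ 2 - B ^ 2) +
        A ^ 2 * (Real.exp (-(4 * R * k.im)) * Real.cos (4 * R * k.re)) := by
    rw [hexp]; simp [pow_two]
  have him : (4 * (k ^ 2 - (B : ℂ) ^ 2) +
      (A : ℂ) ^ 2 * Complex.exp (4 * Complex.I * k * (R : ℂ))).im =
      8 * (k.re * k.im) +
        A ^ 2 * (Real.exp (-(4 * R * k.im)) * Real.sin (4 * R * k.re)) := by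
    rw [hexp]; simp [pow_two]; ring
  rw [h₁, Complex.ext_iff, hre, him, IsZeroPair, Real.cos_neg, Real.sin_neg]
  have hR2 : (4 * R ^ 2 : ℝ) ≠ 0 := by positivity
  simp only [Complex.zero_re, Complex.zero_im]
  constructor
  · rintro ⟨h₂, h₃⟩
    exact ⟨by linear_combination 4 * R ^ 2 * h₂, by linear_combination -(4 * R ^ 2) * h₃⟩
  · rintro ⟨h₂, h₃⟩
    exact ⟨mul_left_cancel₀ hR2 (by linear_combination h₂),
      mul_left_cancel₀ hR2 (by linear_combination -h₃)⟩

lemma deriv_a1_ne_zero {A B R : ℝ} (hA : 0 < A) (hR : 0 < R) {k : ℂ} (hk : 0 < k.im)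
    (hre : k.re ≠ 0) :
    deriv (fun k : ℂ ↦ 1 + (A : ℂ) ^ 2 * Complex.exp (4 * Complex.I * k * (R : ℂ)) /
      (4 * (k ^ 2 - (B : ℂ) ^ 2))) k ≠ 0 := by
  have hne := four_mul_sq_sub_sq_ne_zero_of_im_pos B hk
  have hlin : HasDerivAt (fun k : ℂ ↦ 4 * Complex.I * k * (R : ℂ)) (4 * Complex.I * (R : ℂ)) k := by
    simpa using ((hasDerivAt_id k).const_mul (4 * Complex.I)).mul_const (R : ℂ)
  have hden : HasDerivAt (fun k : ℂ ↦ 4 * (k ^ 2 - (B : ℂ) ^ 2)) (4 * (2 * k)) k := by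
    simpa using ((hasDerivAt_pow 2 k).sub_const ((B : ℂ) ^ 2)).const_mul 4
  have hder := ((hlin.cexp.const_mul ((A : ℂ) ^ 2)).div hden
    hne).const_add 1
  intro h
  replace h := hder.deriv.symm.trans h
  rw [div_eq_zero_iff, or_iff_left (pow_ne_zero 2 hne)] at h
  have hA' : (A : ℂ) ≠ 0 := by exact_mod_cast hA.ne'
  have h₂ : 2 * Complex.I * (R : ℂ) * (k ^ 2 - (B : ℂ) ^ 2) - k = 0 := by
    apply mul_left_cancel₀ (mul_ne_zero (pow_ne_zero 2 hA')
      (Complex.exp_ne_zero (4 * Complex.I * k * (R : ℂ))))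
    linear_combination h / 8
  have h₃ := congrArg Complex.re h₂
  simp [pow_two] at h₃
  have h₄ : k.re * (4 * R * k.im + 1) = 0 := by linear_combination -h₃
  have : 0 < 4 * R * k.im + 1 := by positivity
  rcases mul_eq_zero.1 h₄ with h₄ | h₄
  · exact hre h₄
  · exact this.ne' h₄

lemma isZeroPair_neg_iff {a c u v : ℝ} : IsZeroPair a c (-u) v ↔ IsZeroPair a c u v := by
  simp only [IsZeroPair, Real.cos_neg, Real.sin_neg, neg_sq]
  refine and_congr_right fun _ ↦ ⟨fun h ↦ ?_, fun h ↦ ?_⟩ <;> linear_combination -h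

/-- If `4|B|R ≤ π` and `(2n−1)π/(2√(4B²+A²)) < R ≤ (2n+1)π/(2√(4B²+A²))` for some positive
integer `n`, then the set of zeros of `a₁(k) = 1 + A²e^{4ikR}/(4(k² − B²))` with `Im k > 0` and
`Re k ≠ 0` consists of exactly `2n` simple zeros, is invariant under `p ↦ −conj p`, and its `n`
elements with negative real part can be ordered so that the `j`-th one has real part in
`(−jπ/(2R), (1−2j)π/(4R))`, with exactly one such zero in each of these intervals. -/
theorem a1_offaxis_zeros (A B R : ℝ) (hA : 0 < A) (hR : 0 < R)
    (hBR : 4 * |B| * R ≤ Real.pi)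
    (a₁ : ℂ → ℂ)
    (ha₁ : ∀ k : ℂ, a₁ k =
      1 + (A : ℂ) ^ 2 * Complex.exp (4 * Complex.I * k * (R : ℂ)) / (4 * (k ^ 2 - (B : ℂ) ^ 2)))
    (n : ℕ) (hn : 1 ≤ n)
    (hlow : (2 * (n : ℝ) - 1) * Real.pi / (2 * Real.sqrt (4 * B ^ 2 + A ^ 2)) < R)
    (hhigh : R ≤ (2 * (n : ℝ) + 1) * Real.pi / (2 * Real.sqrt (4 * B ^ 2 + A ^ 2))) :
    let Z : Set ℂ := {k : ℂ | 0 < k.im ∧ k.re ≠ 0 ∧ a₁ k = 0}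
    Z.Finite ∧ Z.ncard = 2 * n ∧
    (∀ k ∈ Z, deriv a₁ k ≠ 0) ∧
    (∀ k : ℂ, k ∈ Z ↔ -(starRingEnd ℂ) k ∈ Z) ∧
    (∃ p : Fin n → ℂ, Function.Injective p ∧
      (∀ j : Fin n, p j ∈ Z ∧ (p j).re < 0 ∧
        -(((j : ℕ) : ℝ) + 1) * Real.pi / (2 * R) < (p j).re ∧
        (p j).re < (1 - 2 * (((j : ℕ) : ℝ) + 1)) * Real.pi / (4 * R)) ∧
      (∀ k ∈ Z, k.re < 0 → ∃! j : Fin n, k = p j)) := by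
  have hπ := Real.pi_pos
  set a : ℝ := 4 * R ^ 2 * A ^ 2 with ha
  set c : ℝ := 16 * B ^ 2 * R ^ 2 with hc
  have ha0 : 0 < a := by positivity
  have hc0 : 0 ≤ c := by positivity
  have hcπ : c ≤ Real.pi ^ 2 := by
    have h : (4 * |B| * R) ^ 2 ≤ Real.pi ^ 2 := by gcongr
    rw [mul_pow, mul_pow, sq_abs] at h
    linarith
  have hsq : 0 < 4 * B ^ 2 + A ^ 2 := by positivity
  have hac : (R * (2 * √(4 * B ^ 2 + A ^ 2))) ^ 2 = a + c := by
    rw [mul_pow, mul_pow, Real.sq_sqrt hsq.le]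
    ring
  have hn' : (1 : ℝ) ≤ n := by exact_mod_cast hn
  rw [div_lt_iff₀ (by positivity)] at hlow
  rw [le_div_iff₀ (by positivity)] at hhigh
  have hlow' : ((2 * (n : ℝ) - 1) * Real.pi) ^ 2 < a + c := by
    rw [← hac]
    have : 0 ≤ (2 * (n : ℝ) - 1) * Real.pi := mul_nonneg (by linarith) hπ.le
    gcongr
  have hhigh' : a + c ≤ ((2 * (n : ℝ) + 1) * Real.pi) ^ 2 := by
    rw [← hac]
    gcongr
  intro Z
  have hZ : ∀ k : ℂ, k ∈ Z ↔
      0 < k.im ∧ k.re ≠ 0 ∧ IsZeroPair a c (-(4 * R * k.re)) (4 * R * k.im) := fun k ↦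
    and_congr_right fun hk ↦ and_congr_right fun _ ↦ by rw [ha₁]; exact a1_eq_zero_iff hR hk
  have hsymm : ∀ k : ℂ, k ∈ Z ↔ -(starRingEnd ℂ) k ∈ Z := fun k ↦ by
    rw [hZ, hZ]
    simp only [Complex.neg_im, Complex.neg_re, Complex.conj_im, Complex.conj_re, neg_neg, ne_eq,
      neg_eq_zero, mul_neg]
    rw [isZeroPair_neg_iff]
  have hex : ∀ j : Fin n, ∃ k ∈ Z, (2 * ((j : ℕ) : ℝ) + 1) * Real.pi < -(4 * R * k.re) ∧
      -(4 * R * k.re) < (2 * ((j : ℕ) : ℝ) + 2) * Real.pi := by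
    intro j
    have hj : (((j : ℕ) : ℝ)) + 1 ≤ n := by exact_mod_cast j.2
    obtain ⟨u, v, hu₁, hu₂, hv, huv⟩ := exists_isZeroPair hcπ j <| by
      refine lt_of_le_of_lt ?_ hlow'
      gcongr
      linarith
    have hu : 0 < u := lt_trans (by positivity) hu₁
    have h₁ : -(4 * R * (-u / (4 * R))) = u := by field_simp
    have h₂ : 4 * R * (v / (4 * R)) = v := by field_simp
    refine ⟨⟨-u / (4 * R), v / (4 * R)⟩, (hZ _).2 ⟨by positivity, ?_, ?_⟩, ?_⟩
    · exact (div_neg_of_neg_of_pos (by linarith) (by positivity)).ne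
    · simpa only [h₁, h₂] using huv
    · simpa only [h₁] using ⟨hu₁, hu₂⟩
  choose p hpZ hp₁ hp₂ using hex
  have hpre : ∀ j, (p j).re < 0 := fun j ↦ by
    have h : 0 < -(4 * R * (p j).re) := lt_trans (by positivity) (hp₁ j)
    by_contra! h'
    have : 0 ≤ 4 * R * (p j).re := by positivity
    linarith
  have hpinj : Function.Injective p := by
    intro i j hij
    have h₁ := hp₁ i
    have h₂ := hp₂ i
    rw [hij] at h₁ h₂
    have h₃ := lt_of_mul_lt_mul_right (h₁.trans (hp₂ j)) hπ.le
    have h₄ := lt_of_mul_lt_mul_right ((hp₁ j).trans h₂) hπ.le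
    have h₅ : 2 * (i : ℕ) + 1 < 2 * (j : ℕ) + 2 := by exact_mod_cast h₃
    have h₆ : 2 * (j : ℕ) + 1 < 2 * (i : ℕ) + 2 := by exact_mod_cast h₄
    exact Fin.ext (by omega)
  have hgap : ∀ (j : ℕ) (u : ℝ), (2 * (j : ℝ) + 1) * Real.pi < u → 0 < u ∧ c < u ^ 2 := by
    intro j u hu
    have : Real.pi < u := lt_of_le_of_lt (by nlinarith [(j.cast_nonneg : (0 : ℝ) ≤ j)]) hu
    exact ⟨hπ.trans this, hcπ.trans_lt (by gcongr)⟩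
  have hsurj : ∀ k ∈ Z, k.re < 0 → ∃ j, k = p j := by
    intro k hk hre
    obtain ⟨him, -, hpair⟩ := (hZ k).1 hk
    have hu : 0 < -(4 * R * k.re) := by
      have := mul_pos (mul_pos four_pos hR) (neg_pos.2 hre)
      linarith
    obtain ⟨j, hj₁, hj₂⟩ := hpair.exists_nat ha0 hu (by positivity)
    have hjn : j < n := by
      have h := hpair.sq_lt ha0 hc0 (by positivity)
      have h₁ := lt_of_pow_lt_pow_left₀ 2 (by positivity) (h.trans_le hhigh')
      have h₂ := lt_of_mul_lt_mul_right (hj₁.trans h₁) hπ.le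
      have h₃ : 2 * j + 1 < 2 * n + 1 := by exact_mod_cast h₂
      omega
    refine ⟨⟨j, hjn⟩, ?_⟩
    obtain ⟨him', -, hpair'⟩ := (hZ _).1 (hpZ ⟨j, hjn⟩)
    have h₁ := hp₁ ⟨j, hjn⟩
    have h₂ := hp₂ ⟨j, hjn⟩
    obtain ⟨hre_eq, him_eq⟩ := hpair.unique hpair' ha0 hc0 hu (hgap j _ h₁).1 (hgap j _ hj₁).2
      (hgap j _ h₁).2 (by positivity) (by positivity) (by linarith) (by linarith)
    have h4R : 4 * R ≠ 0 := by positivity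
    exact Complex.ext (mul_left_cancel₀ h4R (neg_injective hre_eq)) (mul_left_cancel₀ h4R him_eq)
  have hrange : Z = Set.range (Sum.elim p fun j ↦ -(starRingEnd ℂ) (p j)) := by
    ext k
    rw [Set.Sum.elim_range]
    constructor
    · intro hk
      rcases ((hZ k).1 hk).2.1.lt_or_gt with h | h
      · obtain ⟨j, rfl⟩ := hsurj k hk h
        exact Or.inl ⟨j, rfl⟩
      · obtain ⟨j, hj⟩ := hsurj _ ((hsymm k).1 hk) (by simpa using h)
        exact Or.inr ⟨j, by simp [← hj]⟩
    · rintro (⟨j, rfl⟩ | ⟨j, rfl⟩)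
      · exact hpZ j
      · exact (hsymm _).1 (hpZ j)
  have hinj : Function.Injective (Sum.elim p fun j ↦ -(starRingEnd ℂ) (p j)) := by
    refine Function.Injective.sumElim hpinj (fun i j hij ↦ hpinj ?_) fun i j hij ↦ ?_
    · exact (starRingEnd ℂ).injective (neg_injective hij)
    · have h := congrArg Complex.re hij
      simp only [Complex.neg_re, Complex.conj_re] at h
      linarith [hpre i, hpre j]
  refine ⟨hrange ▸ Set.finite_range _, ?_, ?_, hsymm, p, hpinj, fun j ↦ ⟨hpZ j, hpre j, ?_, ?_⟩, ?_⟩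
  · rw [hrange, ← Set.image_univ, Set.ncard_image_of_injective _ hinj, Set.ncard_univ]
    simp [two_mul]
  · intro k hk
    rw [funext ha₁]
    exact deriv_a1_ne_zero hA hR hk.1 hk.2.1
  · rw [div_lt_iff₀ (by positivity)]
    linarith [hp₂ j]
  · rw [lt_div_iff₀ (by positivity)]
    linarith [hp₁ j]
  · intro k hk hre
    obtain ⟨j, hj⟩ := hsurj k hk hre
    exact ⟨j, hj, fun i hi ↦ hpinj (hi.symm.trans hj)⟩
end

section
/- Let c be a real number with 0 ≤ c ≤ π². For an integer n ≥ 1 define y(τ) = −τ cot τ + √(τ² cot² τ + τ² − c) for τ ∈ (2πn − π, 2πn). Then y is a convex function on the interval (2πn − π, 2πn). -/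
/-- The slope at `(t, u)` of the level curves of
`(t, u) ↦ arg (t + a + iu) + arg (t - a + iu) - t`. -/
noncomputable def levelSlope (a t u : ℝ) : ℝ :=
  (1 + (u / ((t + a) ^ 2 + u ^ 2) + u / ((t - a) ^ 2 + u ^ 2))) /
    ((t + a) / ((t + a) ^ 2 + u ^ 2) + (t - a) / ((t - a) ^ 2 + u ^ 2))

/-- The derivative of `levelSlope` along an integral curve. -/
noncomputable def levelCurvature (a t u : ℝ) : ℝ :=
  2 * ((levelSlope a t u * (t + a) - u) * (t + a + levelSlope a t u * u) /
        ((t + a) ^ 2 + u ^ 2) ^ 2 +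
      (levelSlope a t u * (t - a) - u) * (t - a + levelSlope a t u * u) /
        ((t - a) ^ 2 + u ^ 2) ^ 2) /
    ((t + a) / ((t + a) ^ 2 + u ^ 2) + (t - a) / ((t - a) ^ 2 + u ^ 2))

theorem hasDerivAt_levelSlope {a t : ℝ} {f : ℝ → ℝ} (ha : 0 ≤ a) (hat : a < t)
    (hf : HasDerivAt f (levelSlope a t (f t)) t) :
    HasDerivAt (fun s => levelSlope a s (f s)) (levelCurvature a t (f t)) t := by
  have hx : 0 < t + a := by linarith
  have hx' : 0 < t - a := by linarith
  have hP : 0 < (t + a) ^ 2 + f t ^ 2 := by positivity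
  have hP' : 0 < (t - a) ^ 2 + f t ^ 2 := by positivity
  have hD : 0 < (t + a) / ((t + a) ^ 2 + f t ^ 2) + (t - a) / ((t - a) ^ 2 + f t ^ 2) := by
    positivity
  have dx : HasDerivAt (fun s : ℝ => s + a) 1 t := (hasDerivAt_id t).add_const a
  have dx' : HasDerivAt (fun s : ℝ => s - a) 1 t := (hasDerivAt_id t).sub_const a
  have dP := (dx.fun_pow 2).fun_add (hf.fun_pow 2)
  have dP' := (dx'.fun_pow 2).fun_add (hf.fun_pow 2)
  have h := (((hf.fun_div dP hP.ne').fun_add (hf.fun_div dP' hP'.ne')).const_add 1).fun_div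
    ((dx.fun_div dP hP.ne').fun_add (dx'.fun_div dP' hP'.ne')) hD.ne'
  refine h.congr_deriv ?_
  have hN : 1 + (f t / ((t + a) ^ 2 + f t ^ 2) + f t / ((t - a) ^ 2 + f t ^ 2)) =
      levelSlope a t (f t) *
        ((t + a) / ((t + a) ^ 2 + f t ^ 2) + (t - a) / ((t - a) ^ 2 + f t ^ 2)) :=
    (div_mul_cancel₀ _ hD.ne').symm
  rw [hN, levelCurvature]
  generalize levelSlope a t (f t) = m
  generalize hDd : (t + a) / ((t + a) ^ 2 + f t ^ 2) + (t - a) / ((t - a) ^ 2 + f t ^ 2) = D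
    at hD ⊢
  clear hDd h hN
  field_simp
  ring

theorem levelCurvature_nonneg {a t u : ℝ} (ha : 0 ≤ a) (hat : a < t) (hu : 0 < u)
    (h : 2 * a * u ≤ (t - a) * ((t + a) ^ 2 + u ^ 2)) : 0 ≤ levelCurvature a t u := by
  have hx : 0 < t + a := by linarith
  have hx' : 0 < t - a := by linarith
  have hP : 0 < (t + a) ^ 2 + u ^ 2 := by positivity
  have hD : 0 < (t + a) / ((t + a) ^ 2 + u ^ 2) + (t - a) / ((t - a) ^ 2 + u ^ 2) := by
    positivity
  have hm : 0 < levelSlope a t u := by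
    rw [levelSlope]; positivity
  have hq' : 0 ≤ levelSlope a t u * (t - a) - u := by
    have e : levelSlope a t u * (t - a) - u =
        ((t - a) - 2 * a * u / ((t + a) ^ 2 + u ^ 2)) /
          ((t + a) / ((t + a) ^ 2 + u ^ 2) + (t - a) / ((t - a) ^ 2 + u ^ 2)) := by
      rw [levelSlope, eq_div_iff hD.ne', sub_mul, mul_right_comm, div_mul_cancel₀ _ hD.ne']
      field_simp
      ring
    rw [e]
    refine div_nonneg (sub_nonneg.2 ?_) hD.le
    rwa [div_le_iff₀ hP]
  have hq : 0 ≤ levelSlope a t u * (t + a) - u := by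
    nlinarith [mul_nonneg hm.le ha]
  rw [levelCurvature]
  positivity

theorem Real.hasDerivAt_cot {t : ℝ} (h : Real.sin t ≠ 0) :
    HasDerivAt Real.cot (-(1 + Real.cot t ^ 2)) t := by
  have := (Real.hasDerivAt_cos t).fun_div (Real.hasDerivAt_sin t) h
  rw [show Real.cot = fun s => Real.cos s / Real.sin s from
    funext Real.cot_eq_cos_div_sin]
  refine this.congr_deriv ?_
  field_simp
  ring

/-- The larger root `u` of `u² + 2 t u cot t = t² - a²`. -/
noncomputable def upperRoot (a t : ℝ) : ℝ :=
  -t * Real.cot t + √(t ^ 2 * Real.cot t ^ 2 + t ^ 2 - a ^ 2)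

theorem upperRoot_pos {a t : ℝ} (ha : 0 ≤ a) (hat : a < t) : 0 < upperRoot a t := by
  have : t * Real.cot t < √(t ^ 2 * Real.cot t ^ 2 + t ^ 2 - a ^ 2) := by
    apply Real.lt_sqrt_of_sq_lt
    nlinarith
  rw [upperRoot]
  linarith

theorem upperRoot_equation {a t : ℝ} (ha : 0 ≤ a) (hat : a < t) :
    upperRoot a t ^ 2 + 2 * t * upperRoot a t * Real.cot t = t ^ 2 - a ^ 2 := by
  have := Real.sq_sqrt (show 0 ≤ t ^ 2 * Real.cot t ^ 2 + t ^ 2 - a ^ 2 by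
    nlinarith [sq_nonneg (t * Real.cot t)])
  rw [upperRoot]
  linear_combination this

theorem hasDerivAt_upperRoot {a t : ℝ} (ha : 0 ≤ a) (hat : a < t) (hs : Real.sin t ≠ 0) :
    HasDerivAt (upperRoot a) (levelSlope a t (upperRoot a t)) t := by
  have hQ : 0 < t ^ 2 * Real.cot t ^ 2 + t ^ 2 - a ^ 2 := by
    nlinarith [sq_nonneg (t * Real.cot t)]
  have hu := upperRoot_pos ha hat
  have he := upperRoot_equation ha hat
  have ht : 0 < t := ha.trans_lt hat
  have hx : 0 < t + a := by linarith
  have hx' : 0 < t - a := by linarith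
  have dk := Real.hasDerivAt_cot hs
  have dt := hasDerivAt_id' t
  have h := (dt.fun_neg.fun_mul dk).fun_add
    (((((dt.fun_pow 2).fun_mul (dk.fun_pow 2)).fun_add (dt.fun_pow 2)).sub_const
      (a ^ 2)).sqrt hQ.ne')
  refine HasDerivAt.congr_deriv (f := upperRoot a) h ?_
  have hS : √(t ^ 2 * Real.cot t ^ 2 + t ^ 2 - a ^ 2) = upperRoot a t + t * Real.cot t := by
    rw [upperRoot]; ring
  have hk : Real.cot t = (t ^ 2 - a ^ 2 - upperRoot a t ^ 2) / (2 * t * upperRoot a t) := by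
    field_simp
    linear_combination he
  rw [hS, levelSlope]
  generalize upperRoot a t = u at *
  have hS' : u + t * Real.cot t = (u ^ 2 + (t - a) * (t + a)) / (2 * u) := by
    rw [hk]; field_simp; ring
  have hD : (t + a) / ((t + a) ^ 2 + u ^ 2) + (t - a) / ((t - a) ^ 2 + u ^ 2) =
      2 * t * (u ^ 2 + (t - a) * (t + a)) /
        (((t + a) ^ 2 + u ^ 2) * ((t - a) ^ 2 + u ^ 2)) := by
    field_simp; ring
  have hE : 0 < u ^ 2 + (t - a) * (t + a) := by positivity
  simp only [Nat.cast_ofNat, Nat.reduceSub, pow_one]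
  rw [hS', hD, hk]
  field_simp
  ring

theorem one_le_cot_of_sub_pi_lt {t : ℝ} (h₁ : Real.pi < t) (h₂ : t < Real.pi + 1 / 2) :
    1 ≤ Real.cot t := by
  have hpi := Real.pi_gt_three
  have hc : Real.cot t = (Real.tan (t - Real.pi))⁻¹ := by
    rw [Real.tan_sub_pi, Real.tan_inv_eq_cot]
  have h0 : 0 < Real.tan (t - Real.pi) :=
    Real.tan_pos_of_pos_of_lt_pi_div_two (by linarith) (by linarith)
  have h1 : Real.tan (t - Real.pi) < 1 := by
    rw [← Real.tan_pi_div_four]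
    exact Real.tan_lt_tan_of_lt_of_lt_pi_div_two (by linarith) (by linarith) (by linarith)
  rw [hc]
  exact (one_le_inv₀ h0).2 h1.le

theorem two_mul_upperRoot_le {a t : ℝ} (ha : 0 ≤ a) (hap : a ≤ Real.pi) (ht : Real.pi < t) :
    2 * a * upperRoot a t ≤ (t - a) * ((t + a) ^ 2 + upperRoot a t ^ 2) := by
  have hat : a < t := hap.trans_lt ht
  have hpi := Real.pi_gt_three
  have hu := upperRoot_pos ha hat
  have he := upperRoot_equation ha hat
  generalize upperRoot a t = u at *
  rcases le_or_gt (1 / 2) (t - a) with h | h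
  · have h1 : a ≤ (t - a) * (t + a) := by nlinarith
    have h2 : 2 * (t + a) * u ≤ (t + a) ^ 2 + u ^ 2 := two_mul_le_add_sq _ _
    have h3 := mul_le_mul_of_nonneg_left h2 (by linarith : 0 ≤ t - a)
    nlinarith [mul_le_mul_of_nonneg_right h1 hu.le]
  · have hk := one_le_cot_of_sub_pi_lt ht (by linarith)
    have h1 : 2 * a * u ≤ (t - a) * (t + a) := by
      nlinarith [mul_le_mul_of_nonneg_left hk (by nlinarith : 0 ≤ 2 * t * u), sq_nonneg u,
        mul_le_mul_of_nonneg_right hat.le hu.le]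
    have h2 : t + a ≤ (t + a) ^ 2 + u ^ 2 := by nlinarith
    exact h1.trans (mul_le_mul_of_nonneg_left h2 (by linarith))

/-- For `0 ≤ c ≤ π²` and an integer `n ≥ 1`, the function
`y(τ) = −τ cot τ + √(τ²cot²τ + τ² − c)` is convex on the interval `(2πn − π, 2πn)`. -/
theorem y_convex (c : ℝ) (hc0 : 0 ≤ c) (hcpi : c ≤ Real.pi ^ 2)
    (n : ℕ) (hn : 1 ≤ n)
    (y : ℝ → ℝ)
    (hy : ∀ τ : ℝ, y τ = -τ * Real.cot τ +
      Real.sqrt (τ ^ 2 * (Real.cot τ) ^ 2 + τ ^ 2 - c)) :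
    ConvexOn ℝ (Set.Ioo (2 * Real.pi * (n : ℝ) - Real.pi) (2 * Real.pi * (n : ℝ))) y := by
  have hpi := Real.pi_pos
  have hn' : (1 : ℝ) ≤ n := by exact_mod_cast hn
  have ha : 0 ≤ √c := Real.sqrt_nonneg c
  have hap : √c ≤ Real.pi := Real.sqrt_le_iff.2 ⟨hpi.le, hcpi⟩
  obtain rfl : y = upperRoot √c := funext fun τ => by rw [hy, upperRoot, Real.sq_sqrt hc0]
  have hτ : ∀ τ ∈ Set.Ioo (2 * Real.pi * (n : ℝ) - Real.pi) (2 * Real.pi * (n : ℝ)),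
      Real.pi < τ := fun τ h => by nlinarith [h.1]
  have hd : ∀ τ ∈ Set.Ioo (2 * Real.pi * (n : ℝ) - Real.pi) (2 * Real.pi * (n : ℝ)),
      HasDerivAt (upperRoot √c) (levelSlope √c τ (upperRoot √c τ)) τ := fun τ h => by
    refine hasDerivAt_upperRoot ha (hap.trans_lt (hτ τ h)) ?_
    rw [← Real.sin_sub_nat_mul_two_pi τ n]
    exact (Real.sin_neg_of_neg_of_neg_pi_lt (by linarith [h.2]) (by linarith [h.1])).ne
  refine convexOn_of_hasDerivWithinAt2_nonneg (convex_Ioo _ _)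
    (f' := fun τ => levelSlope √c τ (upperRoot √c τ))
    (f'' := fun τ => levelCurvature √c τ (upperRoot √c τ))
    (fun τ h => (hd τ h).continuousAt.continuousWithinAt) ?_ ?_ ?_ <;>
    rw [interior_Ioo] <;> intro τ h <;> have hat := hap.trans_lt (hτ τ h)
  · exact (hd τ h).hasDerivWithinAt
  · exact (hasDerivAt_levelSlope ha hat (hd τ h)).hasDerivWithinAt
  · exact levelCurvature_nonneg ha hat (upperRoot_pos ha hat)
      (two_mul_upperRoot_le ha hap (hτ τ h))
end
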